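/- Fix a constant c with 0 < c ≤ 1 and an integer d ≥ 2. For integers n ≥ 2 with i = c·n an integer, and m = ω(n^(4d+13)), under UNFAIR(m,n,d) the expected load of the i-th least-loaded bin after m balls satisfies E[b_{i(m)}(m)] = d·c^(d−1)·(m/n) + O(m/n²), and with probability 1 − O(n^(−d)) the load b_{i(m)}(m) is within O(m/n^(d+1)) of its expectation. -/

import Mathlib

namespace Unfair

/-- Loads of the `n` bins, starting from `init`, after the balls recorded in `l`
have been placed (each entry of `l` is the bin that received a ball). -/
def loadsOf (n : ℕ) (init : Fin n → ℕ) (l : List (Fin n)) : Fin n → ℕ :=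
  fun b => init b + l.count b

/-- One step of UNFAIR: draw `d` options uniformly from `{1,…,n}^d` (with replacement)
and return the most-loaded option bin, ties broken uniformly at random. -/
noncomputable def stepBin (n d : ℕ) (hn : 0 < n) (hd : 0 < d) (L : Fin n → ℕ) :
    PMF (Fin n) :=
  haveI : NeZero n := ⟨hn.ne'⟩
  haveI : NeZero d := ⟨hd.ne'⟩
  (PMF.uniformOfFintype (Fin d → Fin n)).bind fun opts =>
    PMF.uniformOfFinset
      ((Finset.univ.image opts).filter fun b => ∀ k, L (opts k) ≤ L b)
      (by
        classical
        obtain ⟨b, hb, hmax⟩ := Finset.exists_max_image (Finset.univ.image opts) L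
          (Finset.univ_nonempty.image opts)
        exact ⟨b, Finset.mem_filter.2 ⟨hb, fun k =>
          hmax _ (Finset.mem_image_of_mem _ (Finset.mem_univ k))⟩⟩)

/-- The permutations of `Fin n` that sort the loads `L`: `σ` maps rank (0-indexed,
least-loaded first) to bin, so `L ∘ σ` is monotone. -/
noncomputable def compatPerms (n : ℕ) (L : Fin n → ℕ) : Finset (Equiv.Perm (Fin n)) :=
  @Finset.filter _ (fun σ => Monotone fun i => L (σ i)) (Classical.decPred _) Finset.univ

/-- A uniformly random ranking of the bins by load, ties broken uniformly at random:
a uniform element of the sorting permutations of `L`. -/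
noncomputable def rankPMF (n : ℕ) (L : Fin n → ℕ) : PMF (Equiv.Perm (Fin n)) :=
  PMF.uniformOfFinset (compatPerms n L)
    ⟨Tuple.sort L, by
      simp only [compatPerms, Finset.mem_filter, Finset.mem_univ, true_and]
      exact Tuple.monotone_sort L⟩

/-- The UNFAIR process, run for `m` steps from initial loads `init`.  The outcome is the
history: at each step we record the bin that received the ball together with a uniformly
random load-ranking of the bins (ties broken uniformly at random) just after that step. -/
noncomputable def proc (n d : ℕ) (hn : 0 < n) (hd : 0 < d) (init : Fin n → ℕ) :
    ℕ → PMF (List (Fin n × Equiv.Perm (Fin n)))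
  | 0 => PMF.pure []
  | (m + 1) => (proc n d hn hd init m).bind fun hist =>
      (stepBin n d hn hd (loadsOf n init (hist.map Prod.fst))).bind fun b =>
        (rankPMF n (loadsOf n init (hist.map Prod.fst ++ [b]))).bind fun σ =>
          PMF.pure (hist ++ [(b, σ)])

/-- The loads at time `t` along a history `h`. -/
def trajLoads (n : ℕ) (init : Fin n → ℕ) (h : List (Fin n × Equiv.Perm (Fin n)))
    (t : ℕ) : Fin n → ℕ :=
  loadsOf n init ((h.map Prod.fst).take t)

/-- The ranking permutation at time `s ≥ 1` along a history `h`
(maps rank, 0-indexed least-loaded first, to bin). -/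
def trajRank (n : ℕ) (h : List (Fin n × Equiv.Perm (Fin n))) (s : ℕ) :
    Equiv.Perm (Fin n) :=
  (h.map Prod.snd).getD (s - 1) 1

/-- The load of the `i`-th least-loaded bin (0-indexed) for loads `L`. -/
noncomputable def sortedLoad (n : ℕ) (L : Fin n → ℕ) (i : Fin n) : ℕ :=
  L (Tuple.sort L i)

/-- Expectation of `f` under the distribution `p`. -/
noncomputable def pexp {α : Type*} (p : PMF α) (f : α → ℝ) : ℝ :=
  ∑' a, (p a).toReal * f a

/-- Probability of the event `S` under the distribution `p`, as a real number. -/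
noncomputable def prob {α : Type*} (p : PMF α) (S : Set α) : ℝ :=
  (p.toOuterMeasure S).toReal

/-! ### Helper lemmas -/

/-- Probability that the rank `j` (0-indexed) is the largest among `d` uniform ranks. -/
noncomputable def pr (n d : ℕ) (j : Fin n) : ℝ :=
  (((j : ℕ) + 1 : ℝ) ^ d - ((j : ℕ) : ℝ) ^ d) / (n : ℝ) ^ d

/-- Squared distance of the sorted loads from the ideal profile at time `t`. -/
noncomputable def pot (n d : ℕ) (t : ℝ) (L : Fin n → ℕ) : ℝ :=
  ∑ j, ((sortedLoad n L j : ℝ) - pr n d j * t) ^ 2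

/-- The largest entry of `f`. -/
noncomputable def top (n d : ℕ) (hd : 0 < d) (f : Fin d → Fin n) : Fin n :=
  Finset.univ.sup' ⟨⟨0, hd⟩, Finset.mem_univ _⟩ f

lemma card_top_le (n d : ℕ) (hd : 0 < d) (j : Fin n) :
    (Finset.univ.filter fun f : Fin d → Fin n => top n d hd f ≤ j).card = ((j : ℕ) + 1) ^ d := by
  have : (Finset.univ.filter fun f : Fin d → Fin n => top n d hd f ≤ j)
      = Fintype.piFinset fun _ => Finset.Iic j := by
    ext f
    rw [Finset.mem_filter, Fintype.mem_piFinset]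
    simp only [top, Finset.mem_univ, true_and, Finset.mem_Iic]
    exact (Finset.sup'_le_iff _ _).trans (by simp)
  rw [this]
  simp

lemma card_top_lt (n d : ℕ) (hd : 0 < d) (j : Fin n) :
    (Finset.univ.filter fun f : Fin d → Fin n => top n d hd f < j).card = (j : ℕ) ^ d := by
  have : (Finset.univ.filter fun f : Fin d → Fin n => top n d hd f < j)
      = Fintype.piFinset fun _ => Finset.Iio j := by
    ext f
    rw [Finset.mem_filter, Fintype.mem_piFinset]
    simp only [top, Finset.mem_univ, true_and, Finset.mem_Iio]
    exact (Finset.sup'_lt_iff _).trans (by simp)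
  rw [this]
  simp

lemma card_top_eq (n d : ℕ) (hd : 0 < d) (j : Fin n) :
    ((Finset.univ.filter fun f : Fin d → Fin n => top n d hd f = j).card : ℝ)
      = ((j : ℕ) + 1 : ℝ) ^ d - ((j : ℕ) : ℝ) ^ d := by
  have h : (Finset.univ.filter fun f : Fin d → Fin n => top n d hd f ≤ j).card
      = (Finset.univ.filter fun f : Fin d → Fin n => top n d hd f = j).card
        + (Finset.univ.filter fun f : Fin d → Fin n => top n d hd f < j).card := by
    rw [← Finset.card_union_of_disjoint]
    · congr 1
      ext f
      simp [le_iff_eq_or_lt]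
    · rw [Finset.disjoint_filter]
      intro f _ h1 h2
      exact absurd h1 h2.ne
  rw [card_top_le, card_top_lt] at h
  have h' := congrArg (Nat.cast : ℕ → ℝ) h
  push_cast at h'
  linarith

lemma sum_top (n d : ℕ) (hn : 0 < n) (hd : 0 < d) (g : Fin n → ℝ) :
    ∑ f : Fin d → Fin n, g (top n d hd f) = (n : ℝ) ^ d * ∑ j, pr n d j * g j := by
  rw [← Finset.sum_fiberwise_of_maps_to (s := Finset.univ) (t := Finset.univ)
    (g := top n d hd) (fun _ _ => Finset.mem_univ _), Finset.mul_sum]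
  refine Finset.sum_congr rfl fun j _ => ?_
  rw [Finset.sum_congr rfl (g := fun _ => g j)
    (fun f hf => by rw [(Finset.mem_filter.1 hf).2])]
  rw [Finset.sum_const, nsmul_eq_mul, card_top_eq, pr]
  have : (n : ℝ) ^ d ≠ 0 := by positivity
  field_simp

lemma sum_top_perm (n d : ℕ) (hn : 0 < n) (hd : 0 < d) (σ : Equiv.Perm (Fin n))
    (g : Fin n → ℝ) :
    ∑ f : Fin d → Fin n, g (top n d hd fun k => σ.symm (f k))
      = (n : ℝ) ^ d * ∑ j, pr n d j * g j := by
  rw [← sum_top n d hn hd g]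
  exact Equiv.sum_comp (Equiv.arrowCongr (Equiv.refl (Fin d)) σ.symm)
    (fun f => g (top n d hd f))

lemma sum_pr (n d : ℕ) (hn : 0 < n) (hd : 0 < d) : ∑ j, pr n d j = 1 := by
  have h := sum_top n d hn hd (fun _ => 1)
  have h0 : (n : ℝ) ^ d ≠ 0 := by positivity
  simp only [Finset.sum_const, Finset.card_univ, Fintype.card_fun, Fintype.card_fin,
    nsmul_eq_mul, mul_one] at h
  push_cast at h
  exact (mul_left_cancel₀ h0 (by rw [mul_one]; exact h)).symm

lemma pow_succ_sub_mono (d : ℕ) {x y : ℝ} (hx : 0 ≤ x) (hxy : x ≤ y) :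
    (x + 1) ^ d - x ^ d ≤ (y + 1) ^ d - y ^ d := by
  have key : ∀ z : ℝ, (z + 1) ^ d - z ^ d
      = ∑ i ∈ Finset.range d, (z + 1) ^ i * z ^ (d - 1 - i) := by
    intro z
    rw [← Commute.geom_sum₂_mul (Commute.all _ _)]
    ring
  rw [key, key]
  refine Finset.sum_le_sum fun i _ => ?_
  have hy : 0 ≤ y + 1 := by linarith
  have hy' : 0 ≤ x + 1 := by linarith
  have := pow_nonneg hy i
  gcongr

lemma pr_mono (n d : ℕ) : Monotone (pr n d) := by
  intro a b hab
  unfold pr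
  have : ((a : ℕ) : ℝ) ≤ ((b : ℕ) : ℝ) := by exact_mod_cast hab
  have := pow_succ_sub_mono d (Nat.cast_nonneg (a : ℕ)) this
  gcongr

lemma pot_le (n d : ℕ) (t : ℝ) (ht : 0 ≤ t) (L : Fin n → ℕ) (τ : Equiv.Perm (Fin n)) :
    pot n d t L ≤ ∑ j, ((L (τ j) : ℝ) - pr n d j * t) ^ 2 := by
  unfold pot sortedLoad
  set σ := Tuple.sort L with hσ
  have hmono : Monotone fun j => (L (σ j) : ℝ) := fun a b h => by
    have h' : L (σ a) ≤ L (σ b) := Tuple.monotone_sort L h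
    exact Nat.cast_le.2 h'
  have hmv : Monovary (pr n d) (fun j => (L (σ j) : ℝ)) := (pr_mono n d).monovary hmono
  have h1 := hmv.sum_mul_comp_perm_le_sum_mul (σ := τ.trans σ.symm)
  simp only [Equiv.trans_apply, Equiv.apply_symm_apply] at h1
  have h2 : ∑ j, (L (σ j) : ℝ) ^ 2 = ∑ j, (L (τ j) : ℝ) ^ 2 := by
    rw [Equiv.sum_comp σ (fun b => (L b : ℝ) ^ 2), Equiv.sum_comp τ (fun b => (L b : ℝ) ^ 2)]
  have e : ∀ ρ : Equiv.Perm (Fin n), ∑ j, ((L (ρ j) : ℝ) - pr n d j * t) ^ 2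
      = ∑ j, (L (ρ j) : ℝ) ^ 2 - 2 * t * ∑ j, pr n d j * (L (ρ j) : ℝ)
        + ∑ j, (pr n d j * t) ^ 2 := by
    intro ρ
    rw [Finset.mul_sum, ← Finset.sum_sub_distrib, ← Finset.sum_add_distrib]
    exact Finset.sum_congr rfl fun j _ => by ring
  rw [e, e, h2]
  have := mul_le_mul_of_nonneg_left h1 (by positivity : (0 : ℝ) ≤ 2 * t)
  linarith

/-- Loads after adding one ball to bin `b`. -/
def addBall (n : ℕ) (L : Fin n → ℕ) (b : Fin n) : Fin n → ℕ :=
  fun x => L x + if x = b then 1 else 0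

lemma pot_addBall_le (n d : ℕ) (t : ℝ) (ht : 0 ≤ t) (L : Fin n → ℕ) (b r : Fin n)
    (hb : L b = sortedLoad n L r) :
    pot n d (t + 1) (addBall n L b)
      ≤ ∑ j, ((sortedLoad n L j : ℝ) + (if j = r then 1 else 0) - pr n d j * (t + 1)) ^ 2 := by
  set σ := Tuple.sort L with hσ
  refine (pot_le n d (t + 1) (by linarith) _ (σ.trans (Equiv.swap b (σ r)))).trans
    (le_of_eq ?_)
  refine Finset.sum_congr rfl fun j _ => ?_
  have : addBall n L b ((σ.trans (Equiv.swap b (σ r))) j)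
      = sortedLoad n L j + if j = r then 1 else 0 := by
    have hb' : L b = L (σ r) := hb
    show (L (Equiv.swap b (σ r) (σ j)) + if Equiv.swap b (σ r) (σ j) = b then 1 else 0)
      = L (σ j) + if j = r then 1 else 0
    by_cases h : j = r
    · subst h
      simp [hb']
    · have h1 : σ j ≠ σ r := fun h' => h (σ.injective h')
      by_cases h2 : σ j = b
      · rw [h2, Equiv.swap_apply_left]
        rw [h2] at h1
        simp [h, h1.symm, hb']
      · rw [Equiv.swap_apply_of_ne_of_ne h2 h1]
        simp [h, h2]
  rw [this]
  push_cast
  rfl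

lemma drift (n d : ℕ) (hn : 0 < n) (hd : 0 < d) (t : ℝ) (x : Fin n → ℝ) :
    ∑ r, pr n d r * ∑ j, (x j + (if j = r then 1 else 0) - pr n d j * (t + 1)) ^ 2
      ≤ ∑ j, (x j - pr n d j * t) ^ 2 + 1 := by
  set p := pr n d with hp
  have hs : ∑ j, p j = 1 := sum_pr n d hn hd
  have inner : ∀ r, ∑ j, (x j + (if j = r then 1 else 0) - p j * (t + 1)) ^ 2
      = ∑ j, (x j - p j * t - p j) ^ 2 + (2 * (x r - p r * t - p r) + 1) := by
    intro r
    have : ∀ j, (x j + (if j = r then 1 else 0) - p j * (t + 1)) ^ 2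
        = (x j - p j * t - p j) ^ 2
          + (if j = r then (2 * (x j - p j * t - p j) + 1) else 0) := by
      intro j
      split_ifs <;> ring
    simp only [this, Finset.sum_add_distrib, Finset.sum_ite_eq', Finset.mem_univ, if_true]
  simp only [inner]
  simp only [mul_add (p _), Finset.sum_add_distrib, ← Finset.sum_mul, hs, one_mul, mul_one]
  have : ∑ j, (x j - p j * t - p j) ^ 2 + ∑ r, p r * (2 * (x r - p r * t - p r))
      = ∑ j, (x j - p j * t) ^ 2 - ∑ j, p j ^ 2 := by
    rw [← Finset.sum_add_distrib, ← Finset.sum_sub_distrib]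
    exact Finset.sum_congr rfl fun j _ => by ring
  have h2 : 0 ≤ ∑ j, p j ^ 2 := Finset.sum_nonneg fun j _ => sq_nonneg _
  linarith

open scoped ENNReal in
/-- Expectation in `ℝ≥0∞`. -/
noncomputable def eexp {α : Type*} (p : PMF α) (f : α → ℝ≥0∞) : ℝ≥0∞ :=
  ∑' a, p a * f a

open scoped ENNReal in
lemma eexp_bind {α β : Type*} (p : PMF α) (q : α → PMF β) (f : β → ℝ≥0∞) :
    eexp (p.bind q) f = eexp p fun a => eexp (q a) f := by
  unfold eexp
  simp only [PMF.bind_apply, ← ENNReal.tsum_mul_right, ← ENNReal.tsum_mul_left]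
  rw [ENNReal.tsum_comm]
  simp only [mul_assoc]

open scoped ENNReal in
lemma eexp_pure {α : Type*} (a : α) (f : α → ℝ≥0∞) : eexp (PMF.pure a) f = f a := by
  classical
  unfold eexp
  rw [tsum_eq_single a]
  · simp
  · intro b hb
    simp [PMF.pure_apply, hb]

open scoped ENNReal in
lemma eexp_le {α : Type*} (p : PMF α) (f : α → ℝ≥0∞) (c : ℝ≥0∞)
    (h : ∀ a, p a ≠ 0 → f a ≤ c) : eexp p f ≤ c := by
  unfold eexp
  calc ∑' a, p a * f a ≤ ∑' a, p a * c := by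
        refine ENNReal.tsum_le_tsum fun a => ?_
        by_cases h0 : p a = 0
        · simp [h0]
        · exact mul_le_mul_right (h a h0) _
    _ = c := by rw [ENNReal.tsum_mul_right, p.tsum_coe, one_mul]

open scoped ENNReal in
lemma eexp_mono {α : Type*} (p : PMF α) (f g : α → ℝ≥0∞)
    (h : ∀ a, p a ≠ 0 → f a ≤ g a) : eexp p f ≤ eexp p g := by
  unfold eexp
  refine ENNReal.tsum_le_tsum fun a => ?_
  by_cases h0 : p a = 0
  · simp [h0]
  · exact mul_le_mul_right (h a h0) _

lemma step_drift (n d : ℕ) (hn : 0 < n) (hd : 0 < d) (t : ℝ) (ht : 0 ≤ t) (L : Fin n → ℕ) :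
    eexp (stepBin n d hn hd L) (fun b => ENNReal.ofReal (pot n d (t + 1) (addBall n L b)))
      ≤ ENNReal.ofReal (pot n d t L + 1) := by
  have : NeZero n := ⟨hn.ne'⟩
  have : NeZero d := ⟨hd.ne'⟩
  unfold stepBin
  rw [eexp_bind]
  set σ := Tuple.sort L with hσ
  set G : Fin n → ℝ := fun r =>
    ∑ j, ((sortedLoad n L j : ℝ) + (if j = r then 1 else 0) - pr n d j * (t + 1)) ^ 2 with hG
  have hG0 : ∀ r, 0 ≤ G r := fun r => Finset.sum_nonneg fun j _ => sq_nonneg _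
  refine (eexp_mono _ _
    (fun f => ENNReal.ofReal (G (top n d hd fun k => σ.symm (f k)))) ?_).trans ?_
  · intro f _
    refine eexp_le _ _ _ fun b hb => ENNReal.ofReal_le_ofReal ?_
    have hb' := (PMF.mem_support_uniformOfFinset_iff _ b).1 ((PMF.mem_support_iff _ _).2 hb)
    rw [Finset.mem_filter, Finset.mem_image] at hb'
    obtain ⟨⟨k, -, rfl⟩, hmax⟩ := hb'
    refine pot_addBall_le n d t ht L _ _ ?_
    have hmono : Monotone fun j => L (σ j) := Tuple.monotone_sort L
    apply le_antisymm
    · have h1 : σ.symm (f k) ≤ top n d hd fun k => σ.symm (f k) :=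
        Finset.le_sup' (fun k => σ.symm (f k)) (Finset.mem_univ k)
      have h2 := hmono h1
      simp only [Equiv.apply_symm_apply] at h2
      exact h2
    · obtain ⟨k', -, hk'⟩ := Finset.exists_mem_eq_sup' (s := Finset.univ)
        ⟨(⟨0, hd⟩ : Fin d), Finset.mem_univ _⟩ (fun k => σ.symm (f k))
      have h3 : top n d hd (fun k => σ.symm (f k)) = σ.symm (f k') := hk'
      rw [h3]
      have := hmax k'
      simpa [sortedLoad, ← hσ] using this
  · unfold eexp
    rw [tsum_fintype]
    have hcard : ∀ f : Fin d → Fin n, (PMF.uniformOfFintype (Fin d → Fin n)) f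
        = ENNReal.ofReal (((n : ℝ) ^ d)⁻¹) := by
      intro f
      rw [PMF.uniformOfFintype_apply, ENNReal.ofReal_inv_of_pos (by positivity)]
      congr 1
      rw [Fintype.card_fun, Fintype.card_fin, Fintype.card_fin,
        ENNReal.ofReal_pow (Nat.cast_nonneg n), ENNReal.ofReal_natCast, Nat.cast_pow]
    simp only [hcard]
    rw [← Finset.mul_sum, ← ENNReal.ofReal_sum_of_nonneg (fun _ _ => hG0 _),
      ← ENNReal.ofReal_mul (by positivity)]
    refine ENNReal.ofReal_le_ofReal ?_
    rw [sum_top_perm n d hn hd σ G, ← mul_assoc, inv_mul_cancel₀ (by positivity), one_mul]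
    exact drift n d hn hd t fun j => (sortedLoad n L j : ℝ)

lemma loadsOf_append (n : ℕ) (l : List (Fin n)) (b : Fin n) :
    loadsOf n 0 (l ++ [b]) = addBall n (loadsOf n 0 l) b := by
  funext x
  simp only [loadsOf, addBall, List.count_append, List.count_singleton, Pi.zero_apply, zero_add,
    beq_iff_eq]
  by_cases h : x = b
  · simp [h]
  · simp [h, Ne.symm h]

lemma proc_pot (n d : ℕ) (hn : 0 < n) (hd : 0 < d) (m : ℕ) :
    eexp (proc n d hn hd 0 m)
      (fun h => ENNReal.ofReal (pot n d m (loadsOf n 0 (h.map Prod.fst)))) ≤ m := by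
  induction m with
  | zero =>
    simp only [proc]
    rw [eexp_pure]
    simp [pot, sortedLoad, loadsOf]
  | succ m ih =>
    simp only [proc]
    rw [eexp_bind]
    calc _ ≤ eexp (proc n d hn hd 0 m) (fun h =>
          ENNReal.ofReal (pot n d m (loadsOf n 0 (h.map Prod.fst))) + 1) := by
          refine eexp_mono _ _ _ fun h _ => ?_
          rw [eexp_bind]
          refine le_trans ?_ ((step_drift n d hn hd m (Nat.cast_nonneg m)
            (loadsOf n 0 (h.map Prod.fst))).trans ?_)
          · refine eexp_mono _ _ _ fun b _ => ?_
            rw [eexp_bind]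
            refine eexp_le _ _ _ fun σ _ => ?_
            rw [eexp_pure]
            simp only [List.map_append, List.map_cons, List.map_nil, loadsOf_append]
            push_cast
            exact le_rfl
          · rw [ENNReal.ofReal_add (by unfold pot; exact Finset.sum_nonneg fun j _ => sq_nonneg _)
              zero_le_one]
            simp
      _ ≤ ((m + 1 : ℕ) : ENNReal) := by
          unfold eexp at ih ⊢
          simp only [mul_add, mul_one]
          rw [ENNReal.tsum_add, PMF.tsum_coe]
          push_cast
          gcongr

lemma proc_length (n d : ℕ) (hn : 0 < n) (hd : 0 < d) (m : ℕ) :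
    ∀ h, proc n d hn hd 0 m h ≠ 0 → h.length = m := by
  induction m with
  | zero =>
    intro h hh
    rw [← PMF.mem_support_iff] at hh
    simp only [proc, PMF.mem_support_pure_iff] at hh
    simp [hh]
  | succ m ih =>
    intro h hh
    rw [← PMF.mem_support_iff] at hh
    simp only [proc, PMF.mem_support_bind_iff, PMF.mem_support_pure_iff] at hh
    obtain ⟨h0, hh0, b, -, σ, -, rfl⟩ := hh
    simp [ih h0 ((PMF.mem_support_iff _ _).1 hh0)]

lemma proc_second_moment (n d : ℕ) (hn : 0 < n) (hd : 0 < d) (m : ℕ) (i : Fin n) :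
    eexp (proc n d hn hd 0 m)
      (fun h => ENNReal.ofReal
        (((sortedLoad n (trajLoads n 0 h m) i : ℝ) - pr n d i * m) ^ 2)) ≤ m := by
  refine le_trans ?_ (proc_pot n d hn hd m)
  refine eexp_mono _ _ _ fun h hh => ENNReal.ofReal_le_ofReal ?_
  have hl := proc_length n d hn hd m h hh
  have : trajLoads n 0 h m = loadsOf n 0 (h.map Prod.fst) := by
    unfold trajLoads
    rw [List.take_of_length_le (by simp [hl])]
  rw [this]
  exact Finset.single_le_sum
    (f := fun j => ((sortedLoad n (loadsOf n 0 (h.map Prod.fst)) j : ℝ) - pr n d j * m) ^ 2)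
    (fun j _ => sq_nonneg _) (Finset.mem_univ i)

lemma sortedLoad_le (n m : ℕ) (h : List (Fin n × Equiv.Perm (Fin n))) (i : Fin n) :
    sortedLoad n (trajLoads n 0 h m) i ≤ m := by
  unfold sortedLoad trajLoads loadsOf
  simp only [Pi.zero_apply, zero_add]
  exact List.count_le_length.trans (List.length_take_le _ _)

lemma pmf_summable {α : Type*} (p : PMF α) : Summable fun a => (p a).toReal :=
  ENNReal.summable_toReal p.tsum_coe_ne_top

lemma pmf_tsum {α : Type*} (p : PMF α) : ∑' a, (p a).toReal = 1 := by
  rw [← ENNReal.tsum_toReal_eq (fun a => p.apply_ne_top a), p.tsum_coe, ENNReal.toReal_one]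

lemma pmf_summable_mul {α : Type*} (p : PMF α) (f : α → ℝ) (B : ℝ) (hf : ∀ a, |f a| ≤ B) :
    Summable fun a => (p a).toReal * f a := by
  refine Summable.of_norm_bounded ((pmf_summable p).mul_right B) fun a => ?_
  rw [Real.norm_eq_abs, abs_mul, abs_of_nonneg ENNReal.toReal_nonneg]
  exact mul_le_mul_of_nonneg_left (hf a) ENNReal.toReal_nonneg

lemma pexp_sq_le {α : Type*} (p : PMF α) (f : α → ℝ) (a v : ℝ) (hv : 0 ≤ v)
    (h : eexp p (fun x => ENNReal.ofReal ((f x - a) ^ 2)) ≤ ENNReal.ofReal v) :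
    pexp p (fun x => (f x - a) ^ 2) ≤ v := by
  unfold pexp
  unfold eexp at h
  have h1 : ∑' x, (p x).toReal * (f x - a) ^ 2
      = (∑' x, p x * ENNReal.ofReal ((f x - a) ^ 2)).toReal := by
    rw [ENNReal.tsum_toReal_eq]
    · refine tsum_congr fun x => ?_
      rw [ENNReal.toReal_mul, ENNReal.toReal_ofReal (sq_nonneg _)]
    · intro x
      exact ENNReal.mul_ne_top (p.apply_ne_top x) ENNReal.ofReal_ne_top
  rw [h1]
  exact ENNReal.toReal_le_of_le_ofReal hv h

lemma mean_close {α : Type*} (p : PMF α) (f : α → ℝ) (a s B : ℝ) (hs : 0 < s)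
    (hf : ∀ x, |f x| ≤ B) (h : pexp p (fun x => (f x - a) ^ 2) ≤ s ^ 2) :
    |pexp p f - a| ≤ s := by
  have hB : ∀ x, |(f x - a) ^ 2| ≤ (B + |a|) ^ 2 := fun x => by
    rw [abs_pow]
    have := abs_sub (f x) a
    have := hf x
    gcongr
    linarith
  have S0 := pmf_summable p
  have S1 := pmf_summable_mul p f B hf
  have S2 := pmf_summable_mul p (fun x => (f x - a) ^ 2) _ hB
  have key : 0 ≤ pexp p (fun x => (f x - pexp p f) ^ 2) :=
    tsum_nonneg fun x => mul_nonneg ENNReal.toReal_nonneg (sq_nonneg _)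
  have e : pexp p (fun x => (f x - pexp p f) ^ 2)
      = pexp p (fun x => (f x - a) ^ 2) - (pexp p f - a) ^ 2 := by
    set μ := pexp p f with hμ
    have e1 : ∀ x, (p x).toReal * (f x - μ) ^ 2 = (p x).toReal * (f x - a) ^ 2
        + ((2 * (a - μ)) * ((p x).toReal * f x) + (μ ^ 2 - a ^ 2) * (p x).toReal) := by
      intro x
      ring
    have hμ' : ∑' x, (p x).toReal * f x = μ := rfl
    unfold pexp
    simp only [e1]
    rw [S2.tsum_add ((S1.mul_left _).add (S0.mul_left _)),
      (S1.mul_left _).tsum_add (S0.mul_left _), tsum_mul_left, tsum_mul_left, pmf_tsum, hμ']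
    ring
  exact abs_le_of_sq_le_sq (by linarith) hs.le

lemma chebyshev {α : Type*} (p : PMF α) (f : α → ℝ) (a v r : ℝ) (hr : 0 < r) (hv : 0 ≤ v)
    (h : eexp p (fun x => ENNReal.ofReal ((f x - a) ^ 2)) ≤ ENNReal.ofReal v) (S : Set α)
    (hS : ∀ x, |f x - a| ≤ r → x ∈ S) :
    1 - v / r ^ 2 ≤ prob p S := by
  classical
  have h1 : (1 : ENNReal) ≤ p.toOuterMeasure S + ENNReal.ofReal (v / r ^ 2) := by
    rw [PMF.toOuterMeasure_apply]
    calc (1 : ENNReal) = ∑' x, p x := p.tsum_coe.symm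
      _ ≤ ∑' x, (S.indicator p x + p x * ENNReal.ofReal ((f x - a) ^ 2)
            * ENNReal.ofReal ((r ^ 2)⁻¹)) := by
          refine ENNReal.tsum_le_tsum fun x => ?_
          by_cases hx : x ∈ S
          · simp [hx]
          · have hx' : r < |f x - a| := not_le.1 fun h' => hx (hS x h')
            rw [mul_assoc, ← ENNReal.ofReal_mul (sq_nonneg _)]
            have : 1 ≤ (f x - a) ^ 2 * (r ^ 2)⁻¹ := by
              rw [← div_eq_mul_inv, one_le_div (by positivity), ← sq_abs (f x - a)]
              gcongr
            have h2 : (1 : ENNReal) ≤ ENNReal.ofReal ((f x - a) ^ 2 * (r ^ 2)⁻¹) := by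
              rw [← ENNReal.ofReal_one]
              exact ENNReal.ofReal_le_ofReal this
            calc p x = p x * 1 := (mul_one _).symm
              _ ≤ _ := mul_le_mul_right h2 _
              _ ≤ _ := le_add_self
      _ = ∑' x, S.indicator p x + (∑' x, p x * ENNReal.ofReal ((f x - a) ^ 2))
            * ENNReal.ofReal ((r ^ 2)⁻¹) := by
          rw [ENNReal.tsum_add, ENNReal.tsum_mul_right]
      _ ≤ _ := by
          rw [div_eq_mul_inv, ENNReal.ofReal_mul hv]
          unfold eexp at h
          gcongr
  have hfin : p.toOuterMeasure S ≠ ⊤ := by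
    rw [PMF.toOuterMeasure_apply]
    refine ne_top_of_le_ne_top p.tsum_coe_ne_top (ENNReal.tsum_le_tsum fun x => ?_)
    exact Set.indicator_le_self' (fun _ _ => zero_le) x
  have h2 := ENNReal.toReal_mono (ENNReal.add_ne_top.2 ⟨hfin, ENNReal.ofReal_ne_top⟩) h1
  rw [ENNReal.toReal_add hfin ENNReal.ofReal_ne_top, ENNReal.toReal_one,
    ENNReal.toReal_ofReal (by positivity)] at h2
  unfold prob
  linarith

lemma pow_diff_upper (k : ℕ) (x : ℝ) (hx : 1 ≤ x) :
    x ^ (k + 1) - (x - 1) ^ (k + 1) ≤ (k + 1) * x ^ k := by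
  induction k with
  | zero => simp
  | succ k ih =>
    have h1 : (x - 1) ^ (k + 1) ≤ x ^ (k + 1) :=
      pow_le_pow_left₀ (by linarith) (by linarith) _
    have h2 := mul_le_mul_of_nonneg_left ih (by linarith : (0 : ℝ) ≤ x)
    push_cast
    have e1 : x ^ (k + 1 + 1) - (x - 1) ^ (k + 1 + 1)
        = x * (x ^ (k + 1) - (x - 1) ^ (k + 1)) + (x - 1) ^ (k + 1) := by ring
    have e2 : ((k : ℝ) + 1 + 1) * x ^ (k + 1) = x * ((k + 1) * x ^ k) + x ^ (k + 1) := by ring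
    linarith

lemma pow_diff_lower (k : ℕ) (x : ℝ) (hx : 1 ≤ x) :
    (k + 1) * (x - 1) ^ k ≤ x ^ (k + 1) - (x - 1) ^ (k + 1) := by
  induction k with
  | zero => simp
  | succ k ih =>
    have h1 : (x - 1) ^ (k + 1) ≤ x ^ (k + 1) :=
      pow_le_pow_left₀ (by linarith) (by linarith) _
    have h2 := mul_le_mul_of_nonneg_left ih (by linarith : (0 : ℝ) ≤ x - 1)
    push_cast
    have e1 : x ^ (k + 1 + 1) - (x - 1) ^ (k + 1 + 1)
        = (x - 1) * (x ^ (k + 1) - (x - 1) ^ (k + 1)) + x ^ (k + 1) := by ring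
    have e2 : ((k : ℝ) + 1 + 1) * (x - 1) ^ (k + 1)
        = (x - 1) * ((k + 1) * (x - 1) ^ k) + (x - 1) ^ (k + 1) := by ring
    linarith

lemma pr_approx (n d : ℕ) (hd : 2 ≤ d) (c : ℝ) (i : ℕ) (hi : (i : ℝ) = c * n) (hi1 : 1 ≤ i)
    (hi2 : i ≤ n) :
    |pr n d ⟨i - 1, by omega⟩ - d * c ^ (d - 1) / n| ≤ (d : ℝ) ^ 2 / (n : ℝ) ^ 2 := by
  obtain ⟨k, rfl⟩ : ∃ k, d = k + 2 := ⟨d - 2, by omega⟩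
  have hn : (0 : ℝ) < n := by
    have : 0 < n := by omega
    exact_mod_cast this
  have hx : (1 : ℝ) ≤ i := by exact_mod_cast hi1
  have hxn : (i : ℝ) ≤ n := by exact_mod_cast hi2
  have hc : c = i / n := by field_simp; linarith
  have e : pr n (k + 2) ⟨i - 1, by omega⟩ - ((k + 2 : ℕ) : ℝ) * c ^ (k + 2 - 1) / n
      = ((i : ℝ) ^ (k + 2) - ((i : ℝ) - 1) ^ (k + 2) - (k + 2) * (i : ℝ) ^ (k + 1))
        / (n : ℝ) ^ (k + 2) := by
    have h1 : k + 2 - 1 = k + 1 := by omega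
    unfold pr
    simp only [h1]
    rw [hc, Nat.cast_sub hi1]
    push_cast
    rw [div_pow]
    field_simp
    ring
  rw [e, abs_div, abs_of_pos (by positivity : (0 : ℝ) < (n : ℝ) ^ (k + 2)),
    div_le_div_iff₀ (by positivity) (by positivity)]
  have u1 := pow_diff_upper (k + 1) i hx
  have l1 := pow_diff_lower (k + 1) i hx
  have u2 := pow_diff_upper k i hx
  push_cast at u1 l1 u2 ⊢
  have h3 : (i : ℝ) ^ k ≤ (n : ℝ) ^ k := pow_le_pow_left₀ (by linarith) hxn _
  have hk : (0 : ℝ) ≤ k := Nat.cast_nonneg k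
  have h4 := mul_le_mul_of_nonneg_left u2 (by linarith : (0 : ℝ) ≤ k + 2)
  have h5 : ((k : ℝ) + 2) * ((k + 1) * (i : ℝ) ^ k) ≤ ((k : ℝ) + 2) ^ 2 * (n : ℝ) ^ k := by
    have : (0 : ℝ) ≤ (i : ℝ) ^ k := by positivity
    calc ((k : ℝ) + 2) * ((k + 1) * (i : ℝ) ^ k)
        ≤ ((k : ℝ) + 2) * ((k + 2) * (n : ℝ) ^ k) := by
          gcongr
          linarith
      _ = _ := by ring
  have habs : |(i : ℝ) ^ (k + 2) - ((i : ℝ) - 1) ^ (k + 2) - (k + 2) * (i : ℝ) ^ (k + 1)|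
      ≤ ((k : ℝ) + 2) ^ 2 * (n : ℝ) ^ k := by
    rw [abs_le]
    have e1 : (i : ℝ) ^ (k + 2) = (i : ℝ) ^ (k + 1 + 1) := rfl
    have e2 : ((i : ℝ) - 1) ^ (k + 2) = ((i : ℝ) - 1) ^ (k + 1 + 1) := rfl
    have h6 : 0 ≤ ((k : ℝ) + 2) ^ 2 * (n : ℝ) ^ k := by positivity
    constructor <;> rw [e1, e2] <;> linarith
  calc _ ≤ ((k : ℝ) + 2) ^ 2 * (n : ℝ) ^ k * (n : ℝ) ^ 2 :=
        mul_le_mul_of_nonneg_right habs (by positivity)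
    _ = _ := by ring

end Unfair

open Unfair in
/-- **Corollary (power-law form).** Fix a constant `0 < c ≤ 1` and an integer `d ≥ 2`,
and let `m = m(n)` satisfy `m = ω(n^(4d+13))`.  Then for all sufficiently large `n ≥ 2`
with `i = c·n` an integer, under `UNFAIR(m,n,d)` the expected load of the `i`-th
least-loaded bin after `m` balls is `d·c^(d−1)·(m/n) + O(m/n²)`, and with probability
`1 − O(n^(−d))` the load is within `O(m/n^(d+1))` of its expectation. -/
theorem unfair_power_law (c : ℝ) (hc0 : 0 < c) (hc1 : c ≤ 1)
    (d : ℕ) (hd2 : 2 ≤ d) (m : ℕ → ℕ)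
    (hm : ∀ K : ℝ, ∃ N : ℕ, ∀ n : ℕ, N ≤ n → K * (n : ℝ) ^ (4 * d + 13) ≤ m n) :
    ∃ C₁ C₂ C₃ : ℝ, 0 < C₁ ∧ 0 < C₂ ∧ 0 < C₃ ∧ ∃ N : ℕ,
      ∀ n : ℕ, N ≤ n → ∀ hn2 : 2 ≤ n,
        ∀ i : ℕ, (i : ℝ) = c * n → ∀ hi1 : 1 ≤ i, ∀ hi2 : i ≤ n,
          |pexp (proc n d (by omega) (by omega) 0 (m n))
              (fun h => (sortedLoad n (trajLoads n 0 h (m n)) ⟨i - 1, by omega⟩ : ℝ))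
            - d * c ^ (d - 1) * ((m n : ℝ) / n)|
            ≤ C₁ * (m n) / (n : ℝ) ^ 2 ∧
          1 - C₂ / (n : ℝ) ^ d ≤
            prob (proc n d (by omega) (by omega) 0 (m n))
              {h | |(sortedLoad n (trajLoads n 0 h (m n)) ⟨i - 1, by omega⟩ : ℝ)
                  - pexp (proc n d (by omega) (by omega) 0 (m n))
                      (fun h' =>
                        (sortedLoad n (trajLoads n 0 h' (m n)) ⟨i - 1, by omega⟩ : ℝ))|
                ≤ C₃ * (m n) / (n : ℝ) ^ (d + 1)} := by
  obtain ⟨N, hN⟩ := hm 1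
  refine ⟨(d : ℝ) ^ 2 + 1, 1, 2, by positivity, one_pos, two_pos, N, ?_⟩
  intro n hNn hn2 i hi hi1 hi2
  have hn1 : (1 : ℝ) ≤ n := by exact_mod_cast (by omega : 1 ≤ n)
  have hn0 : (0 : ℝ) < n := by linarith
  have hmn : (n : ℝ) ^ (4 * d + 13) ≤ m n := by simpa using hN n hNn
  set M : ℝ := (m n : ℝ) with hM
  have hpowle : ∀ k : ℕ, k ≤ 4 * d + 13 → (n : ℝ) ^ k ≤ M := fun k hk =>
    (pow_le_pow_right₀ hn1 hk).trans hmn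
  have hM0 : 0 < M := lt_of_lt_of_le (by positivity) hmn
  set P := proc n d (by omega) (by omega) 0 (m n) with hP
  set f : List (Fin n × Equiv.Perm (Fin n)) → ℝ :=
    fun h => (sortedLoad n (trajLoads n 0 h (m n)) ⟨i - 1, by omega⟩ : ℝ) with hf
  set a : ℝ := pr n d ⟨i - 1, by omega⟩ * M with ha
  have hsec : eexp P (fun h => ENNReal.ofReal ((f h - a) ^ 2)) ≤ ENNReal.ofReal M := by
    rw [hM, ENNReal.ofReal_natCast]
    exact proc_second_moment n d (by omega) (by omega) (m n) ⟨i - 1, by omega⟩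
  have hsq : Real.sqrt M ^ 2 = M := Real.sq_sqrt hM0.le
  have hfb : ∀ h, |f h| ≤ M := fun h => by
    rw [hf, hM]
    simp only [Nat.abs_cast]
    exact_mod_cast sortedLoad_le n (m n) h _
  have hmean : |pexp P f - a| ≤ Real.sqrt M :=
    mean_close P f a _ M (Real.sqrt_pos.2 hM0) hfb
      (by rw [hsq]; exact pexp_sq_le P f a M hM0.le hsec)
  have hsqrt : ∀ k : ℕ, 2 * k ≤ 4 * d + 13 → Real.sqrt M ≤ M / (n : ℝ) ^ k := by
    intro k hk
    rw [Real.sqrt_le_left (by positivity), div_pow, le_div_iff₀ (by positivity), sq M]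
    have := hpowle (2 * k) hk
    rw [← pow_mul, mul_comm k 2]
    gcongr
  refine ⟨?_, ?_⟩
  · have h1 := pr_approx n d hd2 c i hi hi1 hi2
    have h2 : |a - d * c ^ (d - 1) * (M / n)| ≤ (d : ℝ) ^ 2 / (n : ℝ) ^ 2 * M := by
      have e : a - d * c ^ (d - 1) * (M / n)
          = (pr n d ⟨i - 1, by omega⟩ - d * c ^ (d - 1) / n) * M := by
        rw [ha]
        ring
      rw [e, abs_mul, abs_of_pos hM0]
      exact mul_le_mul_of_nonneg_right h1 hM0.le
    have h3 := hsqrt 2 (by omega)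
    have h4 := abs_sub_le (pexp P f) a (d * c ^ (d - 1) * (M / n))
    have e : ((d : ℝ) ^ 2 + 1) * M / (n : ℝ) ^ 2
        = M / (n : ℝ) ^ 2 + (d : ℝ) ^ 2 / (n : ℝ) ^ 2 * M := by ring
    rw [e]
    linarith
  · have hr : 0 < M / (n : ℝ) ^ (d + 1) := by positivity
    have h1 := hsqrt (d + 1) (by omega)
    refine le_trans ?_ (chebyshev P f a M (M / (n : ℝ) ^ (d + 1)) hr hM0.le hsec _ ?_)
    · have : M / (M / (n : ℝ) ^ (d + 1)) ^ 2 ≤ 1 / (n : ℝ) ^ d := by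
        have e : M / (M / (n : ℝ) ^ (d + 1)) ^ 2 = (n : ℝ) ^ (2 * d + 2) / M := by
          field_simp
          ring
        rw [e, div_le_div_iff₀ hM0 (by positivity), one_mul, ← pow_add]
        exact hpowle _ (by omega)
      linarith
    · intro h hh
      show |f h - pexp P f| ≤ 2 * M / (n : ℝ) ^ (d + 1)
      have h2 := abs_sub_le (f h) a (pexp P f)
      rw [abs_sub_comm a] at h2
      have e : 2 * M / (n : ℝ) ^ (d + 1) = M / (n : ℝ) ^ (d + 1) + M / (n : ℝ) ^ (d + 1) := by
        ring
      rw [e]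
      linarith
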